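/- Let β > 0, ρ ∈ [0, 1/2], μ ∈ (0, 2π]. For k ∈ ℕ and 0 ≤ s ≤ k set h_{k,s}(θ) = C(β, k)·C(k, s)·(1/(2π))^(β−k)·(ρ/π)^k·θ^(β−k)·cos(θ − μ)·[ (sin μ)^s·(sin(θ − μ))^(k−s)·M₀(θ) + (sin μ)^(k−s)·(sin(θ − μ))^s·M₁(θ) ], where M₀(θ) = 1 if |sin(θ − μ)| ≥ |sin(μ)| and 0 otherwise, and M₁ = 1 − M₀. Assume each h_{k,s} is integrable on (0, 2π) and ∑_{k=0}^∞ ∑_{s=0}^{k} ∫₀^{2π} |h_{k,s}(θ)| dθ < ∞. Then the first sine moment satisfies β₁ := ∫₀^{2π} sin(θ − μ)·f(θ) dθ = −sin(μ) − ∑_{k=0}^∞ ∑_{s=0}^{k} ∫₀^{2π} h_{k,s}(θ) dθ. -/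

import Mathlib

open Real MeasureTheory

/-- Generalized binomial coefficient `C(β, k) = β (β-1) ⋯ (β-k+1) / k!`. -/
noncomputable def genBinom (β : ℝ) (k : ℕ) : ℝ :=
  (∏ i ∈ Finset.range k, (β - i)) / (Nat.factorial k)

theorem genBinom_eq_choose (β : ℝ) (k : ℕ) : genBinom β k = Ring.choose β k := by
  rw [Ring.choose_eq_smul, genBinom, smul_eq_mul, div_eq_inv_mul]
  congr 1
  induction k with
  | zero => simp
  | succ n ih =>
    rw [Finset.prod_range_succ, ih, descPochhammer_succ_right, Polynomial.smeval_mul]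
    simp [Polynomial.smeval_natCast]

theorem hasSum_genBinom (β z : ℝ) (hz : |z| < 1) :
    HasSum (fun k : ℕ => genBinom β k * z ^ k) ((1 + z) ^ β) := by
  have h := (Real.one_add_rpow_hasFPowerSeriesOnBall_zero (a := β)).hasSum (y := z)
    (by simpa [enorm_eq_nnnorm, ← NNReal.coe_lt_coe] using hz)
  simp only [zero_add] at h
  refine (congrArg (fun f : ℕ → ℝ => HasSum f ((1 + z) ^ β)) (funext fun k => ?_)).mpr h
  rw [genBinom_eq_choose, binomialSeries_apply]
  simp

theorem abs_sin_shift_lt (θ μ : ℝ) (hθ : 0 < θ) :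
    |Real.sin (θ - μ) + Real.sin μ| < θ := by
  have e : Real.sin (θ - μ) + Real.sin μ = 2 * Real.sin (θ / 2) * Real.cos ((θ - 2 * μ) / 2) := by
    have := Real.sin_sub_sin (θ - μ) (-μ)
    rw [Real.sin_neg, sub_neg_eq_add] at this
    rw [this]; ring_nf
  rw [e, abs_mul, abs_mul, abs_two]
  have h1 : |Real.sin (θ / 2)| < |θ / 2| := Real.abs_sin_lt_abs (by positivity)
  rw [abs_of_pos (by positivity : 0 < θ / 2)] at h1
  have h2 := Real.abs_cos_le_one ((θ - 2 * μ) / 2)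
  nlinarith [abs_nonneg (Real.sin (θ / 2)), abs_nonneg (Real.cos ((θ - 2 * μ) / 2))]

theorem abs_y_lt (ρ θ μ : ℝ) (hρ0 : 0 ≤ ρ) (hρ1 : ρ ≤ 1 / 2) (hθ : 0 < θ) :
    |(ρ / π) * (Real.sin (θ - μ) + Real.sin μ)| < θ / (2 * π) := by
  have h := abs_sin_shift_lt θ μ hθ
  have hp := Real.pi_pos
  rw [abs_mul, abs_of_nonneg (by positivity : 0 ≤ ρ / π)]
  have e : θ / (2 * π) = (1 / 2 / π) * θ := by field_simp
  rw [e]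
  calc _ ≤ (1 / 2 / π) * |Real.sin (θ - μ) + Real.sin μ| := by gcongr
    _ < _ := by gcongr

theorem base_pos (ρ θ μ : ℝ) (hρ0 : 0 ≤ ρ) (hρ1 : ρ ≤ 1 / 2) (hθ : 0 < θ) :
    0 < θ / (2 * π) + (ρ / π) * (Real.sin (θ - μ) + Real.sin μ) := by
  have := (abs_lt.1 (abs_y_lt ρ θ μ hρ0 hρ1 hθ)).1
  linarith

theorem hasSum_rpow_add (β x y : ℝ) (hx : 0 < x) (hy : |y| < x) :
    HasSum (fun k : ℕ => genBinom β k * x ^ (β - (k : ℝ)) * y ^ k) ((x + y) ^ β) := by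
  have hz : |y / x| < 1 := by rwa [abs_div, abs_of_pos hx, div_lt_one hx]
  have h := (hasSum_genBinom β (y / x) hz).mul_left (x ^ β)
  have e : x ^ β * (1 + y / x) ^ β = (x + y) ^ β := by
    rw [← Real.mul_rpow hx.le (by linarith [(abs_lt.1 hz).1])]
    congr 1; field_simp
  rw [e] at h
  refine (congrArg (fun f : ℕ → ℝ => HasSum f ((x + y) ^ β)) (funext fun k => ?_)).mpr h
  rw [Real.rpow_sub hx, Real.rpow_natCast, div_pow]
  ring

theorem by_parts (β ρ μ : ℝ) (hβ : 0 < β) (hρ0 : 0 ≤ ρ) (hρ1 : ρ ≤ 1 / 2) :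
    ∫ θ in (0 : ℝ)..(2 * π),
        Real.sin (θ - μ) *
          ((β / (2 * π)) *
            (θ / (2 * π) + (ρ / π) * (Real.sin (θ - μ) + Real.sin μ)) ^ (β - 1) *
            (1 + 2 * ρ * Real.cos (θ - μ))) =
      -Real.sin μ - ∫ θ in (0 : ℝ)..(2 * π), Real.cos (θ - μ) *
        (θ / (2 * π) + (ρ / π) * (Real.sin (θ - μ) + Real.sin μ)) ^ β := by
  have hp := Real.pi_pos
  have h2p : (0 : ℝ) ≤ 2 * π := by positivity
  have hcont : Continuous fun θ : ℝ =>
      (θ / (2 * π) + (ρ / π) * (Real.sin (θ - μ) + Real.sin μ)) ^ β := by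
    refine Continuous.rpow_const (by fun_prop) (fun _ => Or.inr hβ.le)
  have hsin : ∀ θ : ℝ, HasDerivAt (fun θ : ℝ => Real.sin (θ - μ)) (Real.cos (θ - μ)) θ := by
    intro θ
    have := ((hasDerivAt_id θ).sub_const μ).sin
    simpa using this
  have hder : ∀ θ ∈ Set.Ioo (min 0 (2 * π)) (max 0 (2 * π)), HasDerivAt (fun θ : ℝ =>
      (θ / (2 * π) + (ρ / π) * (Real.sin (θ - μ) + Real.sin μ)) ^ β)
      ((β / (2 * π)) *
            (θ / (2 * π) + (ρ / π) * (Real.sin (θ - μ) + Real.sin μ)) ^ (β - 1) *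
            (1 + 2 * ρ * Real.cos (θ - μ))) θ := by
    intro θ hθ
    rw [min_eq_left h2p] at hθ
    have hb := base_pos ρ θ μ hρ0 hρ1 hθ.1
    have h1 := hsin θ
    have h2 := ((hasDerivAt_id θ).div_const (2 * π)).add
      ((h1.add_const (Real.sin μ)).const_mul (ρ / π))
    have h3 := h2.rpow_const (p := β) (Or.inl hb.ne')
    refine h3.congr_deriv ?_
    simp only [id, Pi.add_apply]
    field_simp
  have hnn : ∀ θ : ℝ, 0 ≤ 1 + 2 * ρ * Real.cos (θ - μ) := by
    intro θ
    nlinarith [Real.neg_one_le_cos (θ - μ), Real.cos_le_one (θ - μ)]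
  have hii := intervalIntegral.intervalIntegrable_deriv_of_nonneg hcont.continuousOn hder (by
    intro θ hθ
    rw [min_eq_left h2p] at hθ
    have hb := base_pos ρ θ μ hρ0 hρ1 hθ.1
    have := hnn θ
    positivity)
  have key := intervalIntegral.integral_mul_deriv_eq_deriv_mul_of_hasDerivAt
    (u := fun θ : ℝ => Real.sin (θ - μ)) (u' := fun θ => Real.cos (θ - μ))
    (by fun_prop) hcont.continuousOn
    (fun θ _ => hsin θ)
    hder (Continuous.intervalIntegrable (by fun_prop) _ _) hii
  rw [key]
  have e1 : Real.sin (2 * π - μ) = - Real.sin μ := Real.sin_two_pi_sub μ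
  have e2 : (2 * π) / (2 * π) = 1 := div_self (by positivity)
  simp [e1, e2, Real.zero_rpow hβ.ne']

theorem sum_binom (k : ℕ) (a b c : ℝ) (p : Prop) [Decidable p] :
    ∑ s ∈ Finset.range (k + 1), (Nat.choose k s : ℝ) * c *
      (a ^ s * b ^ (k - s) * (if p then (1 : ℝ) else 0) +
        a ^ (k - s) * b ^ s * (1 - if p then (1 : ℝ) else 0)) = c * (b + a) ^ k := by
  by_cases hp : p
  · simp only [hp, if_true, sub_self, mul_zero, mul_one, add_zero]
    rw [add_comm b a, add_pow, Finset.mul_sum]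
    exact Finset.sum_congr rfl fun s _ => by ring
  · simp only [hp, if_false, sub_zero, mul_zero, mul_one, zero_add]
    rw [add_pow, Finset.mul_sum]
    exact Finset.sum_congr rfl fun s _ => by ring

theorem ec_first_sin_moment (β ρ μ : ℝ) (hβ : 0 < β) (hρ0 : 0 ≤ ρ) (hρ1 : ρ ≤ 1 / 2)
    (hμ0 : 0 < μ) (hμ1 : μ ≤ 2 * π) (h : ℕ → ℕ → ℝ → ℝ)
    (hh : ∀ k s : ℕ, s ≤ k → ∀ θ : ℝ,
      h k s θ = genBinom β k * (Nat.choose k s : ℝ) * (1 / (2 * π)) ^ (β - (k : ℝ)) *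
        (ρ / π) ^ k * θ ^ (β - (k : ℝ)) * Real.cos (θ - μ) *
        ((Real.sin μ) ^ s * (Real.sin (θ - μ)) ^ (k - s) *
            (if |Real.sin (θ - μ)| ≥ |Real.sin μ| then (1 : ℝ) else 0) +
          (Real.sin μ) ^ (k - s) * (Real.sin (θ - μ)) ^ s *
            (1 - if |Real.sin (θ - μ)| ≥ |Real.sin μ| then (1 : ℝ) else 0)))
    (hint : ∀ k s : ℕ, s ≤ k → IntegrableOn (h k s) (Set.Ioo 0 (2 * π)) volume)
    (hsum : Summable fun k : ℕ =>
      ∑ s ∈ Finset.range (k + 1), ∫ θ in (0 : ℝ)..(2 * π), |h k s θ|) :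
    ∫ θ in (0 : ℝ)..(2 * π),
        Real.sin (θ - μ) *
          ((β / (2 * π)) *
            (θ / (2 * π) + (ρ / π) * (Real.sin (θ - μ) + Real.sin μ)) ^ (β - 1) *
            (1 + 2 * ρ * Real.cos (θ - μ))) =
      -Real.sin μ -
        ∑' k : ℕ, ∑ s ∈ Finset.range (k + 1), ∫ θ in (0 : ℝ)..(2 * π), h k s θ := by
  have hp := Real.pi_pos
  have h2p : (0 : ℝ) ≤ 2 * π := by positivity
  rw [by_parts β ρ μ hβ hρ0 hρ1]
  congr 1
  have hIoc : ∀ k s : ℕ, s ≤ k → Integrable (h k s) (volume.restrict (Set.Ioc 0 (2 * π))) := by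
    intro k s hs
    exact (integrableOn_Ioc_iff_integrableOn_Ioo).2 (hint k s hs)
  have hpt : ∀ θ ∈ Set.Ioc 0 (2 * π),
      ∑' k : ℕ, ∑ s ∈ Finset.range (k + 1), h k s θ = Real.cos (θ - μ) *
        (θ / (2 * π) + (ρ / π) * (Real.sin (θ - μ) + Real.sin μ)) ^ β := by
    intro θ hθ
    have hx : 0 < θ / (2 * π) := div_pos hθ.1 (by positivity)
    have hs := (hasSum_rpow_add β _ _ hx (abs_y_lt ρ θ μ hρ0 hρ1 hθ.1)).mul_left
      (Real.cos (θ - μ))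
    rw [← hs.tsum_eq]
    refine tsum_congr fun k => ?_
    have e : (θ / (2 * π)) ^ (β - (k : ℝ)) = (1 / (2 * π)) ^ (β - (k : ℝ)) * θ ^ (β - (k : ℝ)) := by
      rw [← Real.mul_rpow (by positivity) hθ.1.le]
      congr 1; ring
    have := sum_binom k (Real.sin μ) (Real.sin (θ - μ))
      (genBinom β k * (1 / (2 * π)) ^ (β - (k : ℝ)) *
        (ρ / π) ^ k * θ ^ (β - (k : ℝ)) * Real.cos (θ - μ))
      (|Real.sin (θ - μ)| ≥ |Real.sin μ|)
    rw [e, mul_pow]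
    refine Eq.trans ?_ (this.trans (by ring))
    refine Finset.sum_congr rfl fun s hs => ?_
    rw [hh k s (Nat.lt_succ_iff.1 (Finset.mem_range.1 hs)) θ]
    ring
  have hF : ∀ k : ℕ, Integrable (fun θ => ∑ s ∈ Finset.range (k + 1), h k s θ)
      (volume.restrict (Set.Ioc 0 (2 * π))) := fun k =>
    integrable_finsetSum _ fun s hs => hIoc k s (Nat.lt_succ_iff.1 (Finset.mem_range.1 hs))
  have hS : Summable fun k : ℕ => ∫ θ in Set.Ioc 0 (2 * π),
      ‖∑ s ∈ Finset.range (k + 1), h k s θ‖ := by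
    refine Summable.of_nonneg_of_le (fun k => integral_nonneg fun _ => norm_nonneg _) (fun k => ?_)
      hsum
    simp only [intervalIntegral.integral_of_le h2p]
    rw [← integral_finsetSum _ fun s hs =>
      (hIoc k s (Nat.lt_succ_iff.1 (Finset.mem_range.1 hs))).abs]
    refine integral_mono (hF k).norm (integrable_finsetSum _ fun s hs =>
      (hIoc k s (Nat.lt_succ_iff.1 (Finset.mem_range.1 hs))).abs) fun θ => ?_
    exact Finset.abs_sum_le_sum_abs _ _
  have key := (hasSum_integral_of_summable_integral_norm hF hS).tsum_eq
  rw [intervalIntegral.integral_of_le h2p, ← setIntegral_congr_fun measurableSet_Ioc hpt, ← key]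
  refine tsum_congr fun k => ?_
  simp only [intervalIntegral.integral_of_le h2p]
  exact integral_finsetSum _ fun s hs => hIoc k s (Nat.lt_succ_iff.1 (Finset.mem_range.1 hs))
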